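/- arXiv:2110.11169 — 2 statements merged into one kernel-verified Lean document; each statement's English description precedes it below -/
import Mathlib

section
/- Let 2 ≤ k ≤ n and let λ ∈ Γ_k ⊂ ℝ^n. Then for all indices i ≠ j, σ_{k-2,ij}(λ) · σ_k(λ) ≤ σ_{k-1,i}(λ) · σ_{k-1,j}(λ); equivalently, σ_{k-2,ij}(λ) − σ_{k-1,i}(λ)σ_{k-1,j}(λ)/σ_k(λ) ≤ 0. -/
open Finset

/-- The `k`-th elementary symmetric polynomial of the values of `lam` on the index set `S`. -/
noncomputable def esymmOn {n : ℕ} (S : Finset (Fin n)) (k : ℕ) (lam : Fin n → ℝ) : ℝ :=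
  ∑ s ∈ S.powersetCard k, ∏ i ∈ s, lam i

/-- The `k`-th elementary symmetric polynomial `σ_k` on `ℝ^n`. -/
noncomputable def sigmaK (n k : ℕ) (lam : Fin n → ℝ) : ℝ :=
  esymmOn (Finset.univ : Finset (Fin n)) k lam

/-- The Gårding cone `Γ_k = {λ : σ_1(λ) > 0, …, σ_k(λ) > 0}`. -/
def GardingCone (n k : ℕ) : Set (Fin n → ℝ) :=
  {lam | ∀ j, 1 ≤ j → j ≤ k → 0 < sigmaK n j lam}

open Polynomial in
lemma lag_aux (s : Multiset ℝ) (x : ℝ) :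
    ((s.map (fun a => X - C a)).prod.eval x) *
      ((derivative (derivative (s.map (fun a => X - C a)).prod)).eval x) ≤
      ((derivative (s.map (fun a => X - C a)).prod).eval x) ^ 2 := by
  induction s using Multiset.induction_on with
  | empty => simp
  | cons a s ih =>
    simp only [Multiset.map_cons, Multiset.prod_cons]
    set g := (s.map (fun a => X - C a)).prod
    simp only [derivative_mul, derivative_add, derivative_sub, derivative_X, derivative_C,
      eval_add, eval_mul, eval_sub, eval_X, eval_C, sub_zero,
      one_mul]
    nlinarith [mul_le_mul_of_nonneg_left ih (sq_nonneg (x - a)), sq_nonneg (g.eval x)]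

open Polynomial in
lemma lag_splits (f : ℝ[X]) (hf : f.Splits) (x : ℝ) :
    f.eval x * (derivative (derivative f)).eval x ≤ ((derivative f).eval x) ^ 2 := by
  have h := hf.eq_prod_roots
  have h2 := lag_aux f.roots x
  rw [h]
  set g := (f.roots.map (fun a => X - C a)).prod
  simp only [derivative_C_mul, eval_mul, eval_C]
  nlinarith [mul_le_mul_of_nonneg_left h2 (sq_nonneg f.leadingCoeff)]

open Polynomial in
lemma splits_deriv (f : ℝ[X]) (hf : f.Splits) : (derivative f).Splits := by
  have h1 := splits_iff_card_roots.1 hf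
  have h2 := card_roots_le_derivative f
  have h3 := card_roots' (derivative f)
  have h4 := natDegree_derivative_le f
  by_cases h0 : f.natDegree = 0
  · rw [derivative_of_natDegree_zero h0]; simp
  · rw [splits_iff_card_roots]; omega

open Polynomial in
lemma newton_coeff (j : ℕ) : ∀ (f : ℝ[X]), f.Splits →
    ((j : ℝ) + 2) * (f.coeff j * f.coeff (j + 2)) ≤ ((j : ℝ) + 1) * f.coeff (j + 1) ^ 2 := by
  induction j with
  | zero =>
    intro f hf
    have := lag_splits f hf 0
    simp only [← coeff_zero_eq_eval_zero, coeff_derivative] at this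
    norm_num at this ⊢
    linarith
  | succ j ih =>
    intro f hf
    have := ih _ (splits_deriv f hf)
    simp only [coeff_derivative] at this
    push_cast at this ⊢
    have hp : (0 : ℝ) < ((j : ℝ) + 1) * (j + 2) := by positivity
    refine le_of_mul_le_mul_left ?_ hp
    ring_nf at this ⊢
    linarith

open Polynomial in
lemma newton_weak {n : ℕ} (S : Finset (Fin n)) (m : ℕ) (lam : Fin n → ℝ) :
    esymmOn S m lam * esymmOn S (m + 2) lam ≤ esymmOn S (m + 1) lam ^ 2 := by
  by_cases h : m + 2 ≤ S.card
  · have key : ∀ r, r ≤ S.card → ((S.val.map lam).map (fun r => X + C r)).prod.coeff (S.card - r)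
        = esymmOn S r lam := by
      intro r hr
      rw [Multiset.prod_X_add_C_coeff _ (by simp)]
      simp only [Multiset.card_map, Finset.card_val]
      rw [Nat.sub_sub_self hr, Finset.esymm_map_val]
      rfl
    have hs : ((S.val.map lam).map (fun r => X + C r)).prod.Splits := by
      apply Splits.multisetProd
      intro f hf
      obtain ⟨r, -, rfl⟩ := Multiset.mem_map.1 hf
      exact Splits.X_add_C r
    have h1 := newton_coeff (S.card - (m + 2)) _ hs
    rw [show S.card - (m + 2) + 2 = S.card - m by omega,
      show S.card - (m + 2) + 1 = S.card - (m + 1) by omega,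
      key _ h, key _ (by omega), key _ (by omega)] at h1
    set j : ℝ := ((S.card - (m + 2) : ℕ) : ℝ)
    have hj : 0 ≤ j := Nat.cast_nonneg _
    by_contra! hc
    nlinarith [mul_le_mul_of_nonneg_left hc.le hj, sq_nonneg (esymmOn S (m + 1) lam)]
  · have : esymmOn S (m + 2) lam = 0 := by
      unfold esymmOn
      rw [Finset.powersetCard_eq_empty.2 (by omega)]; simp
    rw [this, mul_zero]; positivity

lemma esymmOn_erase {n : ℕ} (S : Finset (Fin n)) (a : Fin n) (ha : a ∈ S) (m : ℕ)
    (lam : Fin n → ℝ) :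
    esymmOn S (m + 1) lam = esymmOn (S.erase a) (m + 1) lam + lam a * esymmOn (S.erase a) m lam := by
  have hn : a ∉ S.erase a := Finset.notMem_erase a S
  conv_lhs => rw [← Finset.insert_erase ha]
  unfold esymmOn
  rw [Finset.powersetCard_succ_insert hn, Finset.sum_union, Finset.sum_image, Finset.mul_sum]
  · congr 1
    refine Finset.sum_congr rfl fun s hs => ?_
    rw [Finset.prod_insert fun h => hn ((Finset.mem_powersetCard.1 hs).1 h)]
  · intro s hs t ht hst
    have h1 : a ∉ s := fun h => hn ((Finset.mem_powersetCard.1 hs).1 h)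
    have h2 : a ∉ t := fun h => hn ((Finset.mem_powersetCard.1 ht).1 h)
    rw [← Finset.erase_insert h1, ← Finset.erase_insert h2]
    exact congrArg (fun u => Finset.erase u a) hst
  · rw [Finset.disjoint_left]
    intro s hs ht
    obtain ⟨t, -, rfl⟩ := Finset.mem_image.1 ht
    exact hn ((Finset.mem_powersetCard.1 hs).1 (Finset.mem_insert_self _ _))

/-- for `2 ≤ k ≤ n`, `lam ∈ Γ_k` and indices `i ≠ j`,
`σ_{k-2,ij}(lam) σ_k(lam) ≤ σ_{k-1,i}(lam) σ_{k-1,j}(lam)`; equivalently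
`σ_{k-2,ij}(lam) − σ_{k-1,i}(lam) σ_{k-1,j}(lam)/σ_k(lam) ≤ 0`. -/
theorem sigma_del_ineq (n k : ℕ) (hk2 : 2 ≤ k) (hkn : k ≤ n)
    (lam : Fin n → ℝ) (hlam : lam ∈ GardingCone n k) (i j : Fin n) (hij : i ≠ j) :
    esymmOn ((Finset.univ.erase i).erase j) (k - 2) lam * sigmaK n k lam ≤
        esymmOn (Finset.univ.erase i) (k - 1) lam * esymmOn (Finset.univ.erase j) (k - 1) lam ∧
      esymmOn ((Finset.univ.erase i).erase j) (k - 2) lam -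
          esymmOn (Finset.univ.erase i) (k - 1) lam * esymmOn (Finset.univ.erase j) (k - 1) lam /
            sigmaK n k lam ≤ 0 := by
  have hpos : 0 < sigmaK n k lam := hlam k (by omega) le_rfl
  have main : esymmOn ((Finset.univ.erase i).erase j) (k - 2) lam * sigmaK n k lam ≤
      esymmOn (Finset.univ.erase i) (k - 1) lam * esymmOn (Finset.univ.erase j) (k - 1) lam := by
    obtain ⟨m, rfl⟩ : ∃ m, k = m + 2 := ⟨k - 2, by omega⟩
    have e1 : m + 2 - 2 = m := rfl
    have e2 : m + 2 - 1 = m + 1 := rfl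
    rw [e1, e2]
    unfold sigmaK
    have hji : j ∈ (Finset.univ : Finset (Fin n)).erase i := by simp [hij.symm]
    have hij' : i ∈ (Finset.univ : Finset (Fin n)).erase j := by simp [hij]
    rw [esymmOn_erase Finset.univ i (Finset.mem_univ i) (m + 1) lam,
      esymmOn_erase _ j hji (m + 1) lam, esymmOn_erase _ j hji m lam,
      esymmOn_erase _ i hij' m lam, Finset.erase_right_comm (a := j) (b := i)]
    have := newton_weak ((Finset.univ.erase i).erase j) m lam
    nlinarith
  refine ⟨main, ?_⟩
  rw [sub_nonpos, le_div_iff₀ hpos]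
  exact main
end

section
/- Let 1 ≤ k ≤ n. There exists a constant C(n,k) > 0 depending only on n and k such that for every λ ∈ Γ_k ⊂ ℝ^n, the product Π_{i=1}^n ( σ_{k-1,i}(λ) / σ_k(λ) ) ≥ C(n,k) · σ_k(λ)^{−n/k}. Equivalently, Π_{i=1}^n σ_{k-1,i}(λ) ≥ C(n,k) · σ_k(λ)^{n(k−1)/k}. -/
open Finset

open Polynomial in
lemma laguerre_prod (M : Multiset ℝ) (x : ℝ) :
    ((M.map (fun r => X - C r)).prod).eval x * (derivative (derivative ((M.map (fun r => X - C r)).prod))).eval x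
      ≤ ((derivative ((M.map (fun r => X - C r)).prod)).eval x) ^ 2 := by
  induction M using Multiset.induction_on with
  | empty => simp
  | cons r M ih =>
    rw [Multiset.map_cons, Multiset.prod_cons]
    generalize (M.map (fun r => X - C r)).prod = q at ih ⊢
    simp only [derivative_mul, derivative_sub, derivative_X, derivative_C, sub_zero, one_mul,
      derivative_add, eval_mul, eval_add, eval_sub, eval_X, eval_C]
    nlinarith [sq_nonneg (q.eval x), mul_le_mul_of_nonneg_left ih (sq_nonneg (x - r))]

open Polynomial in
lemma laguerre (p : ℝ[X]) (hp : p.Splits) (x : ℝ) :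
    p.eval x * (derivative (derivative p)).eval x ≤ ((derivative p).eval x) ^ 2 := by
  have h := laguerre_prod p.roots x
  rw [hp.eq_prod_roots]
  generalize (p.roots.map (fun r => X - C r)).prod = q at h ⊢
  simp only [derivative_C_mul, eval_mul, eval_C]
  nlinarith [mul_le_mul_of_nonneg_left h (sq_nonneg p.leadingCoeff)]

open Polynomial in
lemma splits_deriv_s8 (p : ℝ[X]) (hp : p.Splits) : (derivative p).Splits := by
  rw [splits_iff_card_roots] at hp ⊢
  have h1 := card_roots_le_derivative p
  have h2 := card_roots' (derivative p)
  have h3 := natDegree_derivative_le p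
  omega

open Polynomial in
lemma splits_iter (p : ℝ[X]) (hp : p.Splits) (m : ℕ) : (derivative^[m] p).Splits := by
  induction m with
  | zero => simpa
  | succ m ih => rw [Function.iterate_succ_apply']; exact splits_deriv_s8 _ ih

open Polynomial in
lemma newton_coeff_s8 (p : ℝ[X]) (hp : p.Splits) (m : ℕ) :
    p.coeff m * p.coeff (m+2) ≤ p.coeff (m+1) ^ 2 := by
  have h := laguerre _ (splits_iter p hp m) 0
  have e : ∀ l, (derivative^[l] p).eval 0 = (l.factorial : ℝ) * p.coeff l := by
    intro l
    rw [← coeff_zero_eq_eval_zero, coeff_iterate_derivative]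
    simp [Nat.descFactorial_self]
  rw [← Function.iterate_succ_apply' derivative, ← Function.iterate_succ_apply' derivative, e, e, e] at h
  simp only [Nat.factorial_succ, Nat.succ_eq_add_one] at h
  push_cast at h
  have hf : (0:ℝ) < (m.factorial : ℝ) := by positivity
  by_contra hc
  push Not at hc
  have hm : (0:ℝ) ≤ m := by positivity
  set a := p.coeff m
  set b := p.coeff (m+1)
  set c := p.coeff (m+2)
  have h' : ((m:ℝ)+1)*(m.factorial)^2 * ((m+2) * (a*c)) ≤ ((m:ℝ)+1)*(m.factorial)^2 * ((m+1)*b^2) := by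
    nlinarith
  have h2 := le_of_mul_le_mul_left h' (by positivity)
  nlinarith [sq_nonneg b]

open Polynomial in
lemma newton {n : ℕ} (S : Finset (Fin n)) (j : ℕ) (lam : Fin n → ℝ) :
    esymmOn S j lam * esymmOn S (j+2) lam ≤ esymmOn S (j+1) lam ^ 2 := by
  by_cases h : j + 2 ≤ #S
  · have hs : (∏ i ∈ S, (X + C (lam i))).Splits := by
      apply Splits.prod
      intro i _
      exact Splits.X_add_C _
    have := newton_coeff_s8 _ hs (#S - (j+2))
    rw [Finset.prod_X_add_C_coeff _ _ (by omega), Finset.prod_X_add_C_coeff _ _ (by omega),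
      Finset.prod_X_add_C_coeff _ _ (by omega)] at this
    rw [show #S - (#S - (j+2)) = j+2 by omega, show #S - (#S - (j+2) + 2) = j by omega,
      show #S - (#S - (j+2) + 1) = j+1 by omega] at this
    unfold esymmOn
    linarith
  · have : esymmOn S (j+2) lam = 0 := by
      unfold esymmOn
      rw [Finset.powersetCard_eq_empty.2 (by omega)]; simp
    rw [this]; nlinarith [sq_nonneg (esymmOn S (j+1) lam)]

lemma esymm_mem_bij {n : ℕ} (S : Finset (Fin n)) (i : Fin n) (hi : i ∈ S) (j : ℕ) (f : Finset (Fin n) → ℝ) :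
    ∑ s ∈ (S.powersetCard (j+1)).filter (fun s => i ∈ s), f (s.erase i)
      = ∑ s ∈ (S.erase i).powersetCard j, f s := by
  refine Finset.sum_nbij' (fun s => s.erase i) (fun s => insert i s) ?_ ?_ ?_ ?_ ?_
  · intro s hs
    simp only [mem_filter, mem_powersetCard] at hs ⊢
    refine ⟨Finset.erase_subset_erase _ hs.1.1, ?_⟩
    rw [Finset.card_erase_of_mem hs.2, hs.1.2]; rfl
  · intro s hs
    simp only [mem_filter, mem_powersetCard] at hs ⊢
    have : i ∉ s := fun h => by simpa using hs.1 h
    refine ⟨⟨?_, by rw [Finset.card_insert_of_notMem this, hs.2]⟩, by simp⟩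
    exact Finset.insert_subset hi (hs.1.trans (Finset.erase_subset _ _))
  · intro s hs
    simp only [mem_filter] at hs
    exact Finset.insert_erase hs.2
  · intro s hs
    simp only [mem_powersetCard] at hs
    have : i ∉ s := fun h => by simpa using hs.1 h
    exact Finset.erase_insert this
  · intro s _; rfl

lemma esymm_rec {n : ℕ} (S : Finset (Fin n)) (i : Fin n) (hi : i ∈ S) (j : ℕ) (lam : Fin n → ℝ) :
    esymmOn S (j+1) lam = lam i * esymmOn (S.erase i) j lam + esymmOn (S.erase i) (j+1) lam := by
  unfold esymmOn
  rw [← Finset.sum_filter_add_sum_filter_not _ (fun s => i ∈ s)]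
  congr 1
  · rw [← esymm_mem_bij S i hi j, Finset.mul_sum]
    apply Finset.sum_congr rfl
    intro s hs
    simp only [mem_filter] at hs
    rw [Finset.mul_prod_erase _ _ hs.2]
  · apply Finset.sum_congr _ (fun _ _ => rfl)
    ext s
    simp only [mem_filter, mem_powersetCard, Finset.subset_erase]
    tauto

lemma esymm_zero {n : ℕ} (S : Finset (Fin n)) (lam : Fin n → ℝ) : esymmOn S 0 lam = 1 := by
  simp [esymmOn]

lemma garding_pos {n k : ℕ} {lam : Fin n → ℝ} (h : lam ∈ GardingCone n k) (j : ℕ) (hj : j ≤ k) :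
    0 < sigmaK n j lam := by
  rcases Nat.eq_zero_or_pos j with rfl | h0
  · simp [sigmaK, esymm_zero]
  · exact h j h0 hj

lemma garding_erase {n k : ℕ} {lam : Fin n → ℝ} (h : lam ∈ GardingCone n k) (i : Fin n) (j : ℕ)
    (hj : j + 1 ≤ k) : 0 < esymmOn (Finset.univ.erase i) j lam := by
  induction j with
  | zero => simp [esymm_zero]
  | succ j ih =>
    have ha := ih (by omega)
    have h1 := garding_pos h (j+1) (by omega)
    have h2 := garding_pos h (j+2) (by omega)
    unfold sigmaK at h1 h2
    rw [esymm_rec _ i (Finset.mem_univ i)] at h1 h2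
    have hN := newton (Finset.univ.erase i) j lam
    by_contra hc
    push Not at hc
    set a := esymmOn (Finset.univ.erase i) j lam
    set b := esymmOn (Finset.univ.erase i) (j+1) lam
    set c := esymmOn (Finset.univ.erase i) (j+2) lam
    have h2' : 0 < lam i * b + c := h2
    have e1 : a * (-(lam i * b)) < a * c := mul_lt_mul_of_pos_left (by linarith) ha
    nlinarith [mul_nonneg (by linarith : 0 ≤ -b) h1.le]

lemma esymm_congr {n : ℕ} (S : Finset (Fin n)) (j : ℕ) (f g : Fin n → ℝ) (h : ∀ i ∈ S, f i = g i) :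
    esymmOn S j f = esymmOn S j g := by
  unfold esymmOn
  apply Finset.sum_congr rfl
  intro s hs
  apply Finset.prod_congr rfl
  intro i hi
  exact h i ((Finset.mem_powersetCard.1 hs).1 hi)

lemma garding_update {n k : ℕ} {lam : Fin n → ℝ} (h : lam ∈ GardingCone n k) (i : Fin n) (t : ℝ)
    (ht : lam i ≤ t) : Function.update lam i t ∈ GardingCone n k := by
  intro j hj1 hjk
  obtain ⟨j, rfl⟩ : ∃ l, j = l + 1 := ⟨j - 1, by omega⟩
  have h1 := h (j+1) hj1 hjk
  unfold sigmaK at h1 ⊢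
  rw [esymm_rec _ i (Finset.mem_univ i)] at h1 ⊢
  have hc : ∀ l, esymmOn (Finset.univ.erase i) l (Function.update lam i t) =
      esymmOn (Finset.univ.erase i) l lam := by
    intro l
    apply esymm_congr
    intro x hx
    rw [Function.update_of_ne (Finset.ne_of_mem_erase hx)]
  rw [hc, hc, Function.update_self]
  have := garding_erase h i j hjk
  nlinarith

lemma garding_mono {n k : ℕ} {lam nu : Fin n → ℝ} (h : lam ∈ GardingCone n k) (hn : ∀ i, lam i ≤ nu i) :
    nu ∈ GardingCone n k := by
  have key : ∀ T : Finset (Fin n), (fun i => if i ∈ T then nu i else lam i) ∈ GardingCone n k := by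
    intro T
    induction T using Finset.induction_on with
    | empty => simpa
    | insert a T ha ih =>
      have := garding_update ih a (nu a) (by simp [ha, hn])
      convert this using 1
      ext i
      by_cases hi : i = a
      · subst hi; simp
      · simp [hi]
  simpa using key Finset.univ

open Polynomial in
lemma gl_iter (m : ℕ) (P : ℂ[X]) (hP : P ≠ 0) (hm : m ≤ P.natDegree) (hr : ∀ z, P.eval z = 0 → z.im < 0) :
    ∀ z, (derivative^[m] P).eval z = 0 → z.im < 0 := by
  induction m generalizing P with
  | zero => simpa using hr
  | succ m ih =>
    rw [Function.iterate_succ_apply]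
    have hd : 0 < P.natDegree := by omega
    have hdd : (derivative P).natDegree = P.natDegree - 1 := natDegree_derivative P
    have hP' : derivative P ≠ 0 := by
      intro h
      have := derivative_eq_zero.1 h
      omega
    apply ih _ hP' (by omega)
    intro z hz
    have hsub := rootSet_derivative_subset_convexHull_rootSet (natDegree_pos_iff_degree_pos.1 hd)
    have hz' : z ∈ (derivative P).rootSet ℂ := by
      rw [mem_rootSet, coe_aeval_eq_eval]; exact ⟨hP', hz⟩
    have h1 : convexHull ℝ (P.rootSet ℂ) ⊆ {z : ℂ | z.im < 0} := by
      apply convexHull_min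
      · intro w hw
        rw [mem_rootSet, coe_aeval_eq_eval] at hw
        exact hr w hw.2
      · exact convex_halfSpace_im_lt 0
    exact h1 (hsub hz')

open Polynomial in
lemma esymm_ne_zero {n k : ℕ} (hk : k ≤ n) (w : Fin n → ℂ) (hw : ∀ i, 0 < (w i).im) :
    ∑ s ∈ (Finset.univ : Finset (Fin n)).powersetCard k, ∏ i ∈ s, w i ≠ 0 := by
  intro h0
  set P : ℂ[X] := ∏ i : Fin n, (X + C (w i)) with hPdef
  have hmon : P.Monic := monic_prod_of_monic _ _ (fun i _ => monic_X_add_C _)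
  have hdeg : P.natDegree = n := by
    rw [hPdef, natDegree_prod_of_monic _ _ (fun i _ => monic_X_add_C _)]
    simp
  have hr : ∀ z, P.eval z = 0 → z.im < 0 := by
    intro z hz
    rw [hPdef, eval_prod, Finset.prod_eq_zero_iff] at hz
    obtain ⟨i, _, hi⟩ := hz
    simp at hi
    have := congrArg Complex.im hi
    simp at this
    linarith [hw i]
  have h1 := gl_iter (n - k) P hmon.ne_zero (by omega) hr 0 
  have hc : P.coeff (n-k) = 0 := by
    rw [hPdef, Finset.prod_X_add_C_coeff _ _ (by simp)]
    simp only [Finset.card_univ, Fintype.card_fin]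
    rw [show n - (n-k) = k by omega, h0]
  have : (derivative^[n-k] P).eval 0 = 0 := by
    rw [← coeff_zero_eq_eval_zero, coeff_iterate_derivative]
    simp [hc]
  simpa using h1 this

open Polynomial in
/-- the pencil polynomial -/
noncomputable def pencil (n k : ℕ) (lam mu : Fin n → ℝ) : ℝ[X] :=
  ∑ s ∈ (Finset.univ : Finset (Fin n)).powersetCard k, ∏ i ∈ s, (C (mu i) * X + C (lam i))

open Polynomial in
lemma pencil_eval (n k : ℕ) (lam mu : Fin n → ℝ) (t : ℝ) :
    (pencil n k lam mu).eval t = sigmaK n k (fun i => mu i * t + lam i) := by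
  simp [pencil, sigmaK, esymmOn, eval_finsetSum, eval_prod]

open Polynomial in
lemma pencil_deg (n k : ℕ) (lam mu : Fin n → ℝ) : (pencil n k lam mu).natDegree ≤ k := by
  apply natDegree_sum_le_of_forall_le
  intro s hs
  refine (natDegree_prod_le _ _).trans ?_
  rw [← (Finset.mem_powersetCard.1 hs).2, Finset.card_eq_sum_ones]
  exact Finset.sum_le_sum (fun i _ => natDegree_linear_le)

open Polynomial in
lemma pencil_coeff (n k : ℕ) (lam mu : Fin n → ℝ) : (pencil n k lam mu).coeff k = sigmaK n k mu := by
  unfold pencil sigmaK esymmOn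
  rw [finsetSum_coeff]
  apply Finset.sum_congr rfl
  intro s hs
  have := coeff_prod_of_natDegree_le s (fun i => C (mu i) * X + C (lam i)) 1 (fun i _ => natDegree_linear_le)
  rw [(Finset.mem_powersetCard.1 hs).2, mul_one] at this
  rw [this]
  simp

open Polynomial in
lemma pencil_deriv (n k : ℕ) (lam mu : Fin n → ℝ) :
    (derivative (pencil n (k+1) lam mu)).eval 0 = ∑ i, mu i * esymmOn (Finset.univ.erase i) k lam := by
  unfold pencil
  rw [derivative_sum, eval_finsetSum]
  have : ∀ s : Finset (Fin n), (derivative (∏ i ∈ s, (C (mu i) * X + C (lam i)))).eval 0 =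
      ∑ i ∈ s, mu i * ∏ j ∈ s.erase i, lam j := by
    intro s
    rw [derivative_prod_finset, eval_finsetSum]
    apply Finset.sum_congr rfl
    intro i _
    simp [eval_prod]
    ring
  simp_rw [this]
  rw [Finset.sum_comm' (t' := Finset.univ)
    (s' := fun i => ((Finset.univ : Finset (Fin n)).powersetCard (k+1)).filter (fun s => i ∈ s))]
  · apply Finset.sum_congr rfl
    intro i _
    rw [← Finset.mul_sum]
    congr 1
    exact esymm_mem_bij Finset.univ i (Finset.mem_univ i) k (fun s => ∏ j ∈ s, lam j)
  · intro s i
    simp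

open Polynomial in
lemma pencil_splits {n k : ℕ} (hk : k ≤ n) (lam mu : Fin n → ℝ) (hmu : ∀ i, 0 < mu i) :
    (pencil n k lam mu).Splits := by
  apply Splits.of_splits_map (algebraMap ℝ ℂ) (IsAlgClosed.splits _)
  intro z hz
  have hz0 := isRoot_of_mem_roots hz
  have key : ∀ w : ℂ, 0 < w.im → ((pencil n k lam mu).map (algebraMap ℝ ℂ)).eval w ≠ 0 := by
    intro w hw
    have := esymm_ne_zero hk (fun i => (mu i : ℂ) * w + lam i) (by
      intro i; simp; exact mul_pos (hmu i) hw)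
    convert this using 1
    simp [pencil, Polynomial.map_sum, Polynomial.map_prod, eval_finsetSum, eval_prod]
  have hre : z.im = 0 := by
    rcases lt_trichotomy z.im 0 with h | h | h
    · exfalso
      apply key (starRingEnd ℂ z) (by simpa using h)
      rw [eval_map_algebraMap, aeval_conj, ← eval_map_algebraMap, hz0.eq_zero, map_zero]
    · exact h
    · exact absurd hz0 (key z h)
  exact ⟨z.re, Complex.ext (by simp) (by simp [hre])⟩

lemma multi_prod_le (M : Multiset ℝ) (h : ∀ x ∈ M, 0 < x) : M.prod ≤ M.sum ^ M.card ∧ 0 ≤ M.sum ∧ 0 ≤ M.prod := by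
  induction M using Multiset.induction_on with
  | empty => simp
  | cons a M ih =>
    obtain ⟨h1, h2, h3⟩ := ih (fun x hx => h x (by simp [hx]))
    have ha := h a (by simp)
    simp only [Multiset.prod_cons, Multiset.sum_cons, Multiset.card_cons]
    refine ⟨?_, by positivity, by positivity⟩
    rw [pow_succ']
    apply mul_le_mul (by linarith) _ h3 (by positivity)
    exact h1.trans (pow_le_pow_left₀ h2 (by linarith) _)

lemma sigma_pos {n k : ℕ} (hk : k ≤ n) (mu : Fin n → ℝ) (hmu : ∀ i, 0 < mu i) : 0 < sigmaK n k mu := by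
  unfold sigmaK esymmOn
  apply Finset.sum_pos (fun s _ => Finset.prod_pos (fun i _ => hmu i))
  apply Finset.powersetCard_nonempty.2; simpa

open Polynomial in
lemma garding_ineq {n k : ℕ} (hk : k + 1 ≤ n) (lam mu : Fin n → ℝ) (hmu : ∀ i, 0 < mu i)
    (h : lam ∈ GardingCone n (k+1)) :
    sigmaK n (k+1) mu / sigmaK n (k+1) lam ≤
      ((∑ i, mu i * esymmOn (Finset.univ.erase i) k lam) / sigmaK n (k+1) lam) ^ (k+1) := by
  have hs := pencil_splits hk lam mu hmu
  set p := pencil n (k+1) lam mu with hp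
  have hmupos := sigma_pos hk mu hmu
  have hcoef : p.coeff (k+1) = sigmaK n (k+1) mu := pencil_coeff _ _ _ _
  have hdeg : p.natDegree = k+1 := by
    apply le_antisymm (pencil_deg _ _ _ _)
    apply le_natDegree_of_ne_zero
    rw [hcoef]; exact hmupos.ne'
  have hlead : p.leadingCoeff = sigmaK n (k+1) mu := by
    rw [leadingCoeff, hdeg, hcoef]
  have hev : ∀ t, 0 ≤ t → 0 < p.eval t := by
    intro t ht
    rw [hp, pencil_eval]
    apply garding_pos (k := k+1) _ _ le_rfl
    apply garding_mono h
    intro i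
    have := mul_nonneg (hmu i).le ht
    linarith
  have hroot : ∀ r ∈ p.roots, r < 0 := by
    intro r hr
    by_contra hc
    have := hev r (by linarith)
    rw [isRoot_of_mem_roots hr] at this
    exact lt_irrefl _ this
  have h0 : p.eval 0 = sigmaK n (k+1) lam := by
    rw [hp, pencil_eval]; simp
  have hd := hs.eval_derivative_div_eval_of_ne_zero (hev 0 le_rfl).ne'
  rw [h0, hp, pencil_deriv, ← hp] at hd
  rw [hd]
  have hM := (multi_prod_le (p.roots.map fun z ↦ 1 / (0 - z)) (by
    intro x hx
    obtain ⟨r, hr, rfl⟩ := Multiset.mem_map.1 hx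
    have := hroot r hr
    apply one_div_pos.2; linarith)).1
  rw [Multiset.card_map, ← hs.natDegree_eq_card_roots, hdeg] at hM
  refine le_trans (le_of_eq ?_) hM
  have he := hs.eval_eq_prod_roots 0
  rw [h0, hlead] at he
  simp only [one_div]
  rw [Multiset.prod_map_inv]
  have hpos : 0 < sigmaK n (k+1) lam := h0 ▸ hev 0 le_rfl
  have : (p.roots.map (fun r => 0 - r)).prod ≠ 0 := by
    intro hz; rw [hz] at he; linarith
  rw [he]
  field_simp

lemma prod_le_sigma {n k : ℕ} (hk : k ≤ n) (mu : Fin n → ℝ) (hmu : ∀ i, 0 < mu i) :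
    (∏ i, mu i) ^ k ≤ sigmaK n k mu ^ n := by
  rcases Nat.eq_zero_or_pos n with rfl | hn
  · have : k = 0 := by omega
    subst this; simp
  have : NeZero n := ⟨hn.ne'⟩
  obtain ⟨T, _, hT⟩ := Finset.exists_subset_card_eq (s := (Finset.univ : Finset (Fin n))) (n := k) (by simpa)
  have h1 : ∀ j : Fin n, ∏ l ∈ T, mu (j + l) ≤ sigmaK n k mu := by
    intro j
    have : ∏ l ∈ T, mu (j + l) = ∏ i ∈ T.map (addLeftEmbedding j), mu i := by
      rw [Finset.prod_map]; rfl
    rw [this]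
    unfold sigmaK esymmOn
    apply Finset.single_le_sum (f := fun s => ∏ i ∈ s, mu i)
      (fun s _ => Finset.prod_nonneg (fun i _ => (hmu i).le))
    simp [Finset.mem_powersetCard, hT]
  have h2 : ∏ j : Fin n, ∏ l ∈ T, mu (j + l) = (∏ i, mu i) ^ k := by
    rw [Finset.prod_comm, ← hT, ← Finset.prod_const]
    apply Finset.prod_congr rfl
    intro l _
    exact Fintype.prod_equiv (Equiv.addRight l) _ _ (fun _ => rfl)
  rw [← h2]
  refine (Finset.prod_le_prod (fun j _ => Finset.prod_nonneg (fun i _ => (hmu _).le)) (fun j _ => h1 j)).trans ?_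
  simp

/-- there is `C(n,k) > 0` such that for all `lam ∈ Γ_k`,
`Π_i (σ_{k-1,i}(lam)/σ_k(lam)) ≥ C(n,k) σ_k(lam)^{-n/k}`; equivalently
`Π_i σ_{k-1,i}(lam) ≥ C(n,k) σ_k(lam)^{n(k-1)/k}`. -/
theorem det_G_lower_bound (n k : ℕ) (hk1 : 1 ≤ k) (hkn : k ≤ n) :
    ∃ C : ℝ, 0 < C ∧ ∀ lam : Fin n → ℝ, lam ∈ GardingCone n k →
      (∏ i : Fin n, esymmOn (Finset.univ.erase i) (k - 1) lam / sigmaK n k lam) ≥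
          C * sigmaK n k lam ^ (-(n : ℝ) / k) ∧
        (∏ i : Fin n, esymmOn (Finset.univ.erase i) (k - 1) lam) ≥
          C * sigmaK n k lam ^ ((n : ℝ) * ((k : ℝ) - 1) / k) := by
  obtain ⟨k, rfl⟩ : ∃ l, k = l + 1 := ⟨k - 1, by omega⟩
  have hn : 0 < n := by omega
  have hnR : (0:ℝ) < n := by exact_mod_cast hn
  refine ⟨((n:ℝ)^n)⁻¹, by positivity, ?_⟩
  intro lam h
  simp only [Nat.add_sub_cancel]
  have hd : ∀ i, 0 < esymmOn (Finset.univ.erase i) k lam := fun i => garding_erase h i k le_rfl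
  have hs := garding_pos h (k+1) le_rfl
  have hD : 0 < ∏ i, esymmOn (Finset.univ.erase i) k lam := Finset.prod_pos (fun i _ => hd i)
  have hG := garding_ineq hkn lam (fun i => (esymmOn (Finset.univ.erase i) k lam)⁻¹)
    (fun i => inv_pos.2 (hd i)) h
  have hP := prod_le_sigma hkn (fun i => (esymmOn (Finset.univ.erase i) k lam)⁻¹)
    (fun i => inv_pos.2 (hd i))
  have hsum : ∑ i, (esymmOn (Finset.univ.erase i) k lam)⁻¹ * esymmOn (Finset.univ.erase i) k lam = n := by
    rw [Finset.sum_congr rfl (fun i _ => inv_mul_cancel₀ (hd i).ne')]; simp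
  rw [hsum] at hG
  rw [Finset.prod_inv_distrib] at hP
  have hmu := sigma_pos hkn (fun i => (esymmOn (Finset.univ.erase i) k lam)⁻¹)
    (fun i => inv_pos.2 (hd i))
  have main : ((n:ℝ)^n)⁻¹ * sigmaK n (k+1) lam ^ ((n : ℝ) * (((k+1 : ℕ) : ℝ) - 1) / ((k+1 : ℕ) : ℝ))
      ≤ ∏ i, esymmOn (Finset.univ.erase i) k lam := by
    generalize sigmaK n (k+1) (fun i => (esymmOn (Finset.univ.erase i) k lam)⁻¹) = m at *
    generalize (∏ i, esymmOn (Finset.univ.erase i) k lam) = D at *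
    generalize sigmaK n (k+1) lam = s at *
    have hm : m * s ^ k ≤ (n:ℝ)^(k+1) := by
      rw [div_pow, div_le_div_iff₀ hs (by positivity)] at hG
      have : s * (m * s^k) ≤ s * (n:ℝ)^(k+1) := by
        rw [pow_succ s] at hG; linarith
      exact le_of_mul_le_mul_left this hs
    have hk0 : k + 1 ≠ 0 := by omega
    rw [← pow_le_pow_iff_left₀ (by positivity) hD.le hk0]
    have e1 : (s ^ ((n : ℝ) * (((k+1 : ℕ) : ℝ) - 1) / ((k+1 : ℕ) : ℝ))) ^ (k+1) = (s^k)^n := by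
      rw [← Real.rpow_natCast, ← Real.rpow_mul hs.le, ← pow_mul, ← Real.rpow_natCast s]
      congr 1
      push_cast
      field_simp
      ring
    rw [mul_pow, e1]
    rw [inv_pow] at hP
    have h3 : (m * s^k)^n ≤ ((n:ℝ)^(k+1))^n := pow_le_pow_left₀ (by positivity) hm n
    rw [mul_pow] at h3
    rw [inv_pow, ← pow_mul, mul_comm n, pow_mul, inv_mul_le_iff₀ (by positivity)]
    have h4 : (D^(k+1))⁻¹ * (s^k)^n ≤ ((n:ℝ)^(k+1))^n :=
      (mul_le_mul_of_nonneg_right hP (by positivity)).trans h3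
    rw [inv_mul_le_iff₀ (by positivity)] at h4
    linarith
  refine ⟨?_, main⟩
  rw [ge_iff_le, Finset.prod_div_distrib, Finset.prod_const, Finset.card_univ, Fintype.card_fin,
    le_div_iff₀ (by positivity)]
  refine le_trans (le_of_eq ?_) main
  rw [mul_assoc, ← Real.rpow_natCast (sigmaK n (k+1) lam) n, ← Real.rpow_add hs]
  congr 2
  push_cast
  field_simp
  ring
end
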